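/- Let (q_{ij})_{0 ≤ i < j ≤ n} be arbitrary real numbers and set τ₁ := Σ_{0 ≤ i < j ≤ n} q_{ij} T_{i,j} and τ₂ := Σ_{0 ≤ i < j ≤ n} q_{ij} N_{i,j}. Then: (i) τ₁ : τ₂ = Σ_{0 ≤ i < j ≤ n} q_{ij}²; (ii) ‖τ₁‖_F² ≤ ((n+1)n/2) Σ_{0 ≤ i < j ≤ n} q_{ij}²; and (iii) Σ_{0 ≤ i < j ≤ n} q_{ij}² ≤ ‖τ₁‖_F ‖τ₂‖_F. -/

import Mathlib

open Matrix

open Matrix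

/-- The unit tangent vector of the edge `x i x j`: `t_{i,j} = (x j - x i)/‖x j - x i‖`
(Euclidean norm expressed via the dot product). -/
noncomputable def edgeTangent {n : ℕ} (x : Fin (n + 1) → (Fin n → ℝ)) (i j : Fin (n + 1)) :
    Fin n → ℝ :=
  (Real.sqrt ((x j - x i) ⬝ᵥ (x j - x i)))⁻¹ • (x j - x i)

/-- `T_{i,j} = t_{i,j} t_{i,j}ᵀ`. -/
noncomputable def Tmat {n : ℕ} (x : Fin (n + 1) → (Fin n → ℝ)) (i j : Fin (n + 1)) :
    Matrix (Fin n) (Fin n) ℝ :=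
  vecMulVec (edgeTangent x i j) (edgeTangent x i j)

/-- `N_{i,j} = (ν_i ν_jᵀ + ν_j ν_iᵀ) / (2 (ν_iᵀ t_{i,j}) (ν_jᵀ t_{i,j}))`. -/
noncomputable def Nmat {n : ℕ} (x : Fin (n + 1) → (Fin n → ℝ))
    (ν : Fin (n + 1) → (Fin n → ℝ)) (i j : Fin (n + 1)) : Matrix (Fin n) (Fin n) ℝ :=
  (2 * (ν i ⬝ᵥ edgeTangent x i j) * (ν j ⬝ᵥ edgeTangent x i j))⁻¹ •
    (vecMulVec (ν i) (ν j) + vecMulVec (ν j) (ν i))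

/-- The Frobenius inner product `A : B = Σ_{p,q} A_{pq} B_{pq}`. -/
noncomputable def frob {n : ℕ} (A B : Matrix (Fin n) (Fin n) ℝ) : ℝ :=
  ∑ p, ∑ q, A p q * B p q

lemma frob_eq_sum_prod {n : ℕ} (A B : Matrix (Fin n) (Fin n) ℝ) :
    frob A B = ∑ e : Fin n × Fin n, A e.1 e.2 * B e.1 e.2 := by
  rw [frob, Fintype.sum_prod_type]

/-- Cauchy–Schwarz for the Frobenius inner product. -/
lemma frob_le_sqrt_mul_sqrt {n : ℕ} (A B : Matrix (Fin n) (Fin n) ℝ) :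
    frob A B ≤ Real.sqrt (frob A A) * Real.sqrt (frob B B) := by
  simpa only [frob_eq_sum_prod, ← sq] using
    Real.sum_mul_le_sqrt_mul_sqrt Finset.univ
      (fun e : Fin n × Fin n => A e.1 e.2) (fun e => B e.1 e.2)

lemma frob_sum_smul_sum_smul {n : ℕ} {ι : Type*} [Fintype ι] (q r : ι → ℝ)
    (A B : ι → Matrix (Fin n) (Fin n) ℝ) :
    frob (∑ p, q p • A p) (∑ p, r p • B p) = ∑ p, ∑ s, q p * r s * frob (A p) (B s) := by
  simp only [frob_eq_sum_prod, Matrix.sum_apply, Matrix.smul_apply, smul_eq_mul,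
    Finset.sum_mul_sum]
  rw [Finset.sum_comm]
  refine Finset.sum_congr rfl fun p _ => ?_
  rw [Finset.sum_comm]
  simp only [Finset.mul_sum]
  refine Finset.sum_congr rfl fun s _ => Finset.sum_congr rfl fun e _ => ?_
  ring

lemma frob_sum_smul_self_le {n : ℕ} {ι : Type*} [Fintype ι] (q : ι → ℝ)
    (A : ι → Matrix (Fin n) (Fin n) ℝ) :
    frob (∑ p, q p • A p) (∑ p, q p • A p) ≤ (∑ p, frob (A p) (A p)) * ∑ p, q p ^ 2 := by
  simp only [frob_eq_sum_prod, ← sq, Matrix.sum_apply, Matrix.smul_apply, smul_eq_mul]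
  rw [Finset.sum_comm, Finset.sum_mul]
  refine Finset.sum_le_sum fun e _ => ?_
  rw [mul_comm]
  exact Finset.sum_mul_sq_le_sq_mul_sq _ _ _

lemma frob_vecMulVec {n : ℕ} (a b c d : Fin n → ℝ) :
    frob (vecMulVec a b) (vecMulVec c d) = (a ⬝ᵥ c) * (b ⬝ᵥ d) := by
  simp only [frob, vecMulVec_apply, dotProduct, Finset.sum_mul_sum]
  exact Finset.sum_congr rfl fun _ _ => Finset.sum_congr rfl fun _ _ => by ring

lemma frob_smul_add_right {n : ℕ} (A B C : Matrix (Fin n) (Fin n) ℝ) (c : ℝ) :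
    frob A (c • (B + C)) = c * (frob A B + frob A C) := by
  simp only [frob_eq_sum_prod, Matrix.smul_apply, Matrix.add_apply, smul_eq_mul,
    ← Finset.sum_add_distrib, Finset.mul_sum]
  exact Finset.sum_congr rfl fun _ _ => by ring

lemma frob_Tmat_Nmat {n : ℕ} (x ν : Fin (n + 1) → (Fin n → ℝ)) (k l i j : Fin (n + 1)) :
    frob (Tmat x k l) (Nmat x ν i j) =
      (2 * (ν i ⬝ᵥ edgeTangent x i j) * (ν j ⬝ᵥ edgeTangent x i j))⁻¹ *
        (2 * (ν i ⬝ᵥ edgeTangent x k l) * (ν j ⬝ᵥ edgeTangent x k l)) := by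
  rw [Tmat, Nmat, frob_smul_add_right, frob_vecMulVec, frob_vecMulVec,
    dotProduct_comm (ν i) (edgeTangent x k l), dotProduct_comm (ν j) (edgeTangent x k l)]
  ring

lemma sub_ne_zero_of_affineIndependent {n : ℕ} {x : Fin (n + 1) → (Fin n → ℝ)}
    (hx : AffineIndependent ℝ x) {i j : Fin (n + 1)} (hij : i ≠ j) : x j - x i ≠ 0 :=
  sub_ne_zero.mpr fun h => hij (hx.injective h).symm

lemma sqrt_dotProduct_self_pos {n : ℕ} {v : Fin n → ℝ} (hv : v ≠ 0) :
    0 < Real.sqrt (v ⬝ᵥ v) := by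
  refine Real.sqrt_pos.mpr (lt_of_le_of_ne ?_ fun h => hv (dotProduct_self_eq_zero.mp h.symm))
  exact Finset.sum_nonneg fun _ _ => mul_self_nonneg _

lemma edgeTangent_dotProduct_self {n : ℕ} {x : Fin (n + 1) → (Fin n → ℝ)}
    (hx : AffineIndependent ℝ x) {i j : Fin (n + 1)} (hij : i ≠ j) :
    edgeTangent x i j ⬝ᵥ edgeTangent x i j = 1 := by
  have hpos := sqrt_dotProduct_self_pos (sub_ne_zero_of_affineIndependent hx hij)
  have hsq := Real.mul_self_sqrt (Real.sqrt_pos.mp hpos).le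
  rw [edgeTangent, smul_dotProduct, dotProduct_smul, smul_eq_mul, smul_eq_mul]
  nth_rewrite 3 [← hsq]
  field_simp

lemma frob_Tmat_self {n : ℕ} {x : Fin (n + 1) → (Fin n → ℝ)}
    (hx : AffineIndependent ℝ x) {i j : Fin (n + 1)} (hij : i ≠ j) :
    frob (Tmat x i j) (Tmat x i j) = 1 := by
  rw [Tmat, frob_vecMulVec, edgeTangent_dotProduct_self hx hij, one_mul]

/-- A vector orthogonal to a face and to an edge leaving that face vanishes. -/
lemma eq_zero_of_dotProduct_sub_eq_zero {n : ℕ} {x : Fin (n + 1) → (Fin n → ℝ)}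
    (hx : AffineIndependent ℝ x) {v : Fin n → ℝ} {i j : Fin (n + 1)}
    (hface : ∀ k l, k ≠ i → l ≠ i → v ⬝ᵥ (x k - x l) = 0) (hij : j ≠ i)
    (hedge : v ⬝ᵥ (x j - x i) = 0) : v = 0 := by
  have htop : vectorSpan ℝ (Set.range x) = ⊤ :=
    hx.vectorSpan_eq_top_of_card_eq_finrank_add_one (by simp)
  have hspan : vectorSpan ℝ (Set.range x) ≤ LinearMap.ker (dotProductBilin ℝ ℝ v) := by
    rw [vectorSpan_range_eq_span_range_vsub_right ℝ x j, Submodule.span_le]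
    rintro _ ⟨k, rfl⟩
    change v ⬝ᵥ (x k - x j) = 0
    by_cases hk : k = i
    · rw [hk, ← neg_sub, dotProduct_neg, hedge, neg_zero]
    · exact hface k j hk hij
  have hmem : v ∈ LinearMap.ker (dotProductBilin ℝ ℝ v) := hspan (htop ▸ Submodule.mem_top)
  exact dotProduct_self_eq_zero.mp hmem

lemma dotProduct_edgeTangent {n : ℕ} (x : Fin (n + 1) → (Fin n → ℝ)) (v : Fin n → ℝ)
    (i j : Fin (n + 1)) :
    v ⬝ᵥ edgeTangent x i j =
      (Real.sqrt ((x j - x i) ⬝ᵥ (x j - x i)))⁻¹ * (v ⬝ᵥ (x j - x i)) := by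
  rw [edgeTangent, dotProduct_smul, smul_eq_mul]

lemma dotProduct_edgeTangent_ne_zero {n : ℕ} {x : Fin (n + 1) → (Fin n → ℝ)}
    (hx : AffineIndependent ℝ x) {v : Fin n → ℝ} {i j : Fin (n + 1)} (hij : i ≠ j)
    (hv : v ⬝ᵥ (x j - x i) ≠ 0) : v ⬝ᵥ edgeTangent x i j ≠ 0 := by
  rw [dotProduct_edgeTangent]
  exact mul_ne_zero
    (inv_ne_zero (sqrt_dotProduct_self_pos (sub_ne_zero_of_affineIndependent hx hij)).ne') hv

/-- The families `T` and `N` are biorthonormal for the Frobenius inner product. -/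
lemma frob_Tmat_Nmat_eq_ite {n : ℕ} {x ν : Fin (n + 1) → (Fin n → ℝ)}
    (hx : AffineIndependent ℝ x) (hν : ∀ i, ν i ≠ 0)
    (hνorth : ∀ i k l, k ≠ i → l ≠ i → ν i ⬝ᵥ (x k - x l) = 0)
    (p s : {p : Fin (n + 1) × Fin (n + 1) // p.1 < p.2}) :
    frob (Tmat x p.1.1 p.1.2) (Nmat x ν s.1.1 s.1.2) = if p = s then 1 else 0 := by
  rw [frob_Tmat_Nmat]
  split_ifs with h
  · subst h
    obtain ⟨⟨i, j⟩, hij⟩ := p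
    have hne : i ≠ j := ne_of_lt hij
    have hi : ν i ⬝ᵥ edgeTangent x i j ≠ 0 := dotProduct_edgeTangent_ne_zero hx hne fun h =>
      hν i (eq_zero_of_dotProduct_sub_eq_zero hx (hνorth i) hne.symm h)
    have hj : ν j ⬝ᵥ edgeTangent x i j ≠ 0 := dotProduct_edgeTangent_ne_zero hx hne fun h =>
      hν j (eq_zero_of_dotProduct_sub_eq_zero hx (hνorth j) hne
        (by rw [← neg_sub, dotProduct_neg, h, neg_zero]))
    exact inv_mul_cancel₀ (mul_ne_zero (mul_ne_zero two_ne_zero hi) hj)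
  · obtain ⟨⟨k, l⟩, hkl⟩ := p
    obtain ⟨⟨i, j⟩, hij⟩ := s
    have hcases : (l ≠ i ∧ k ≠ i) ∨ (l ≠ j ∧ k ≠ j) := by
      simp only [Subtype.mk.injEq, Prod.mk.injEq] at h hkl hij
      by_contra hcon
      omega
    rcases hcases with ⟨hl, hk⟩ | ⟨hl, hk⟩
    · simp [dotProduct_edgeTangent x _ k l, hνorth i l k hl hk]
    · simp [dotProduct_edgeTangent x _ k l, hνorth j l k hl hk]

lemma card_fin_pairs_lt (n : ℕ) :
    (Fintype.card {p : Fin (n + 1) × Fin (n + 1) // p.1 < p.2} : ℝ) = (n + 1) * n / 2 := by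
  have hcard : Fintype.card {p : Fin (n + 1) × Fin (n + 1) // p.1 < p.2} =
      ∑ i ∈ Finset.range (n + 1), i := by
    rw [Fintype.card_subtype, Finset.card_filter, Fintype.sum_prod_type_right,
      ← Fin.sum_univ_eq_sum_range (fun i => i)]
    refine Finset.sum_congr rfl fun i _ => ?_
    rw [← Finset.card_filter, Finset.filter_gt_eq_Iio, Fin.card_Iio]
  have hgauss := Finset.sum_range_id_mul_two (n + 1)
  rw [← hcard, Nat.add_sub_cancel] at hgauss
  have hreal : (Fintype.card {p : Fin (n + 1) × Fin (n + 1) // p.1 < p.2} : ℝ) * 2 =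
      (n + 1) * n := by exact_mod_cast hgauss
  linarith

/-- For `τ₁ = Σ_{i<j} q_{ij} T_{i,j}` and `τ₂ = Σ_{i<j} q_{ij} N_{i,j}`:
(i) `τ₁ : τ₂ = Σ q_{ij}²`; (ii) `‖τ₁‖_F² ≤ ((n+1)n/2) Σ q_{ij}²`;
(iii) `Σ q_{ij}² ≤ ‖τ₁‖_F ‖τ₂‖_F`. -/
theorem statement6 {n : ℕ} (hn : 1 ≤ n) (x : Fin (n + 1) → (Fin n → ℝ))
    (hx : AffineIndependent ℝ x)
    (ν : Fin (n + 1) → (Fin n → ℝ))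
    (hνunit : ∀ i, ν i ⬝ᵥ ν i = 1)
    (hνorth : ∀ i k l, k ≠ i → l ≠ i → ν i ⬝ᵥ (x k - x l) = 0)
    (q : {p : Fin (n + 1) × Fin (n + 1) // p.1 < p.2} → ℝ)
    (τ₁ τ₂ : Matrix (Fin n) (Fin n) ℝ)
    (hτ₁ : τ₁ = ∑ p : {p : Fin (n + 1) × Fin (n + 1) // p.1 < p.2}, q p • Tmat x p.1.1 p.1.2)
    (hτ₂ : τ₂ = ∑ p : {p : Fin (n + 1) × Fin (n + 1) // p.1 < p.2},
        q p • Nmat x ν p.1.1 p.1.2) :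
    frob τ₁ τ₂ = ∑ p, (q p) ^ 2 ∧
    frob τ₁ τ₁ ≤ ((n + 1) * n / 2 : ℝ) * ∑ p, (q p) ^ 2 ∧
    ∑ p, (q p) ^ 2 ≤ Real.sqrt (frob τ₁ τ₁) * Real.sqrt (frob τ₂ τ₂) := by
  have hν : ∀ i, ν i ≠ 0 := fun i h => by simpa [h] using hνunit i
  have hdual : frob τ₁ τ₂ = ∑ p, (q p) ^ 2 := by
    rw [hτ₁, hτ₂, frob_sum_smul_sum_smul]
    simp [frob_Tmat_Nmat_eq_ite hx hν hνorth, sq]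
  refine ⟨hdual, ?_, hdual ▸ frob_le_sqrt_mul_sqrt τ₁ τ₂⟩
  have hself : ∑ p : {p : Fin (n + 1) × Fin (n + 1) // p.1 < p.2},
      frob (Tmat x p.1.1 p.1.2) (Tmat x p.1.1 p.1.2) = (n + 1) * n / 2 := by
    rw [← card_fin_pairs_lt, Finset.sum_congr rfl fun p _ => frob_Tmat_self hx p.2.ne]
    simp
  rw [hτ₁, ← hself]
  exact frob_sum_smul_self_le q fun p => Tmat x p.1.1 p.1.2
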